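/- arXiv:2405.19713 — 3 statements merged into one kernel-verified Lean document; each statement's English description precedes it below -/
import Mathlib

section
/- Let P ∈ ℂ^{d×d} be positive definite and let (A_k)_{k=0}^∞ be a sequence in ℂ^{d×d}. Define the P-Euler transform E_n^P(A) = Σ_{k=0}^n binom(n,k) (I+P)^{−n−1} P^{n−k} A_k for n ∈ ℕ. If Σ_{k=0}^∞ A_k converges in the conventional sense to S ∈ ℂ^{d×d}, then Σ_{n=0}^∞ E_n^P(A) converges in the conventional sense to S (i.e., Euler summation with respect to P is regular). -/
open scoped ComplexOrder
open Filter Topology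

/-- Binomial means of a null sequence tend to zero. -/
lemma tendsto_binomial_mean_zero {q r : ℝ} (hq : 0 ≤ q) (hr : 0 < r) (hqr : r + q = 1)
    {u : ℕ → ℝ} (hu : Tendsto u atTop (𝓝 0)) :
    Tendsto (fun m => ∑ j ∈ Finset.range (m + 1), (m.choose j : ℝ) * (r ^ j * q ^ (m - j) * u j))
      atTop (𝓝 0) := by
  have hcol : ∀ j, Tendsto (fun m => (m.choose j : ℝ) * (r ^ j * q ^ (m - j) * u j))
      atTop (𝓝 0) := by
    intro j
    rw [← tendsto_add_atTop_iff_nat j]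
    have hq1 : ‖q‖ < 1 := by rw [Real.norm_of_nonneg hq]; linarith
    have h := ((summable_choose_mul_geometric_of_norm_lt_one j hq1).tendsto_atTop_zero).mul_const
      (r ^ j * u j)
    rw [zero_mul] at h
    refine h.congr fun m => ?_
    rw [Nat.add_sub_cancel]
    ring
  rw [Metric.tendsto_atTop]
  intro ε hε
  obtain ⟨K, hK⟩ := Metric.tendsto_atTop.1 hu (ε / 2) (half_pos hε)
  have hhead := tendsto_finsetSum (Finset.range K) fun j _ => (hcol j).abs
  simp only [abs_zero, Finset.sum_const_zero] at hhead
  obtain ⟨M, hM⟩ := (hhead.eventually (gt_mem_nhds (half_pos hε))).exists_forall_of_atTop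
  refine ⟨M, fun m hm => ?_⟩
  rw [dist_zero_right, Real.norm_eq_abs]
  have hsum : ∑ j ∈ Finset.range (m + 1), (m.choose j : ℝ) * (r ^ j * q ^ (m - j)) = 1 := by
    have h := add_pow r q m
    rw [hqr, one_pow] at h
    rw [h]
    exact Finset.sum_congr rfl fun j _ => by ring
  have hw : ∀ j, 0 ≤ (m.choose j : ℝ) * (r ^ j * q ^ (m - j)) := fun j => by positivity
  calc |∑ j ∈ Finset.range (m + 1), (m.choose j : ℝ) * (r ^ j * q ^ (m - j) * u j)|
      ≤ ∑ j ∈ Finset.range (m + 1), |(m.choose j : ℝ) * (r ^ j * q ^ (m - j) * u j)| :=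
        Finset.abs_sum_le_sum_abs _ _
    _ ≤ ∑ j ∈ Finset.range (m + 1),
          ((if j < K then |(m.choose j : ℝ) * (r ^ j * q ^ (m - j) * u j)| else 0)
            + (m.choose j : ℝ) * (r ^ j * q ^ (m - j)) * (ε / 2)) := by
        refine Finset.sum_le_sum fun j _ => ?_
        split_ifs with hj
        · exact le_add_of_nonneg_right (mul_nonneg (hw j) (half_pos hε).le)
        · have h := hK j (not_lt.1 hj)
          rw [dist_zero_right, Real.norm_eq_abs] at h
          rw [zero_add, ← mul_assoc, abs_mul, abs_of_nonneg (hw j)]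
          exact mul_le_mul_of_nonneg_left h.le (hw j)
    _ ≤ ∑ j ∈ Finset.range K, |(m.choose j : ℝ) * (r ^ j * q ^ (m - j) * u j)| + ε / 2 := by
        rw [Finset.sum_add_distrib, ← Finset.sum_mul, hsum, one_mul, ← Finset.sum_filter]
        refine add_le_add_left (Finset.sum_le_sum_of_subset_of_nonneg ?_ ?_) _
        · intro j hj
          simpa using (Finset.mem_filter.1 hj).2
        · exact fun _ _ _ => abs_nonneg _
    _ < ε := by linarith [hM m hm]

/-- Binomial means of a convergent sequence converge to its limit. -/
lemma tendsto_binomial_mean {q r : ℝ} (hq : 0 ≤ q) (hr : 0 < r) (hqr : r + q = 1)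
    {t : ℕ → ℂ} {s : ℂ} (ht : Tendsto t atTop (𝓝 s)) :
    Tendsto (fun m => ∑ j ∈ Finset.range (m + 1),
      (m.choose j : ℂ) * ((r : ℂ) ^ j * (q : ℂ) ^ (m - j) * t j)) atTop (𝓝 s) := by
  rw [tendsto_iff_norm_sub_tendsto_zero]
  refine squeeze_zero (fun _ => norm_nonneg _) (fun m => ?_)
    (tendsto_binomial_mean_zero hq hr hqr (tendsto_iff_norm_sub_tendsto_zero.1 ht))
  have hs : s = ∑ j ∈ Finset.range (m + 1),
      (m.choose j : ℂ) * ((r : ℂ) ^ j * (q : ℂ) ^ (m - j) * s) := by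
    have hqr' : (r : ℂ) + q = 1 := by exact_mod_cast hqr
    have h := add_pow (r : ℂ) q m
    rw [hqr', one_pow] at h
    calc s = 1 * s := (one_mul s).symm
      _ = _ := by
        rw [h, Finset.sum_mul]
        exact Finset.sum_congr rfl fun j _ => by ring
  nth_rewrite 1 [hs]
  rw [← Finset.sum_sub_distrib]
  refine (norm_sum_le _ _).trans (Finset.sum_le_sum fun j _ => le_of_eq ?_)
  rw [← mul_sub, ← mul_sub]
  simp [abs_of_nonneg hq, abs_of_pos hr]

/-- Partial sums of the Euler transform are binomial means of the partial sums. -/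
lemma sum_euler_transform_eq_binomial_mean {R : Type*} [CommRing R] {q r : R} (hqr : r + q = 1)
    (a : ℕ → R) (m : ℕ) :
    ∑ n ∈ Finset.range m, ∑ k ∈ Finset.range (n + 1),
        (n.choose k : R) * (r ^ (k + 1) * q ^ (n - k) * a k) =
      ∑ j ∈ Finset.range (m + 1),
        (m.choose j : R) * (r ^ j * q ^ (m - j) * ∑ k ∈ Finset.range j, a k) := by
  induction m with
  | zero => simp
  | succ m ih =>
    rw [Finset.sum_range_succ, ih, Finset.sum_choose_succ_mul
      (fun i l => r ^ i * q ^ l * ∑ k ∈ Finset.range i, a k) m, ← Finset.sum_add_distrib,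
      ← Finset.sum_add_distrib]
    refine Finset.sum_congr rfl fun j hj => ?_
    have hj' : m + 1 - j = m - j + 1 := Nat.succ_sub (Finset.mem_range_succ_iff.1 hj)
    rw [hj', Finset.sum_range_succ]
    obtain rfl : q = 1 - r := by rw [← hqr]; ring
    ring

/-- Regularity of scalar Euler summation with a positive parameter. -/
lemma tendsto_sum_euler_transform {p : ℝ} (hp : 0 < p) {a : ℕ → ℂ} {s : ℂ}
    (ha : Tendsto (fun n => ∑ k ∈ Finset.range (n + 1), a k) atTop (𝓝 s)) :
    Tendsto (fun N => ∑ n ∈ Finset.range (N + 1), ∑ k ∈ Finset.range (n + 1),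
      (n.choose k : ℂ) * (((1 + (p : ℂ)) ^ (n + 1))⁻¹ * (p : ℂ) ^ (n - k) * a k))
      atTop (𝓝 s) := by
  have hp1 : 0 < 1 + p := by linarith
  have hpc : (1 + (p : ℂ)) ≠ 0 := by exact_mod_cast hp1.ne'
  have hqr : (1 + p)⁻¹ + p * (1 + p)⁻¹ = 1 := by field_simp
  have h := tendsto_binomial_mean (mul_nonneg hp.le (inv_pos.2 hp1).le) (inv_pos.2 hp1) hqr
    ((tendsto_add_atTop_iff_nat (f := fun n => ∑ k ∈ Finset.range n, a k) 1).1 ha)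
  refine ((tendsto_add_atTop_iff_nat 1).2 h).congr fun N => ?_
  rw [← sum_euler_transform_eq_binomial_mean (by exact_mod_cast hqr)]
  refine Finset.sum_congr rfl fun n _ => Finset.sum_congr rfl fun k hk => ?_
  have hn : n + 1 = k + 1 + (n - k) := by have := Finset.mem_range_succ_iff.1 hk; omega
  rw [hn, pow_add (1 + (p : ℂ))]
  push_cast
  rw [mul_pow, mul_inv, inv_pow, inv_pow]
  ring

/-- A diagonalization of `P` intertwines the coefficients of the Euler transform. -/
lemma SemiconjBy.euler_coeff {d : ℕ} {P V : Matrix (Fin d) (Fin d) ℂ} {p : Fin d → ℂ}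
    (hV : SemiconjBy V P (Matrix.diagonal p)) (hP : IsUnit (1 + P)) (hp : ∀ i, 1 + p i ≠ 0)
    (n m : ℕ) :
    SemiconjBy V (((1 + P) ^ n)⁻¹ * P ^ m)
      (Matrix.diagonal fun i => ((1 + p i) ^ n)⁻¹ * p i ^ m) := by
  have h1 : SemiconjBy V ((1 + P) ^ n) (Matrix.diagonal fun i => (1 + p i) ^ n) := by
    have h := ((SemiconjBy.one_right V).add_right hV).pow_right n
    rwa [← Matrix.diagonal_one, Matrix.diagonal_add, Matrix.diagonal_pow,
      Matrix.diagonal_one] at h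
  have h2 : SemiconjBy V ((1 + P) ^ n)⁻¹ (Matrix.diagonal fun i => ((1 + p i) ^ n)⁻¹) := by
    have hu := (Matrix.isUnit_iff_isUnit_det _).1 (hP.pow n)
    have hd : (Matrix.diagonal fun i => ((1 + p i) ^ n)⁻¹) *
        (Matrix.diagonal fun i => (1 + p i) ^ n) = 1 := by
      rw [Matrix.diagonal_mul_diagonal, ← Matrix.diagonal_one]
      congr 1
      funext i
      exact inv_mul_cancel₀ (pow_ne_zero n (hp i))
    calc V * ((1 + P) ^ n)⁻¹
        = (Matrix.diagonal fun i => ((1 + p i) ^ n)⁻¹) *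
            ((Matrix.diagonal fun i => (1 + p i) ^ n) * V) * ((1 + P) ^ n)⁻¹ := by
          rw [← mul_assoc, hd, one_mul]
      _ = (Matrix.diagonal fun i => ((1 + p i) ^ n)⁻¹) * V := by
          rw [← h1.eq, mul_assoc, mul_assoc, Matrix.mul_nonsing_inv _ hu, mul_one]
  have h3 := h2.mul_right (hV.pow_right m)
  rwa [Matrix.diagonal_pow, Matrix.diagonal_mul_diagonal] at h3

/-- **Regularity of Euler summation with positive definite matrix parameter.**
Let `P` be positive definite and let `E n` denote the `P`-Euler transform
`∑_{k≤n} (n choose k) (I+P)^{-(n+1)} P^{n-k} A k`. If `∑ₖ A k` converges in the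
conventional sense to `S`, then `∑ₙ E n` converges in the conventional sense
to `S`. -/
theorem euler_regularity (d : ℕ) (P : Matrix (Fin d) (Fin d) ℂ) (hP : P.PosDef)
    (A : ℕ → Matrix (Fin d) (Fin d) ℂ) (S : Matrix (Fin d) (Fin d) ℂ)
    (hA : Tendsto (fun n => ∑ k ∈ Finset.range (n + 1), A k) atTop (nhds S)) :
    Tendsto (fun N => ∑ n ∈ Finset.range (N + 1),
        ∑ k ∈ Finset.range (n + 1),
          (n.choose k : ℂ) • (((1 + P) ^ (n + 1))⁻¹ * P ^ (n - k) * A k))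
      atTop (nhds S) := by
  let U : Matrix (Fin d) (Fin d) ℂ := hP.1.eigenvectorUnitary
  have hUV : U * star U = 1 := Unitary.coe_mul_star_self hP.1.eigenvectorUnitary
  have hVU : star U * U = 1 := Unitary.coe_star_mul_self hP.1.eigenvectorUnitary
  have hV : SemiconjBy (star U) P (Matrix.diagonal fun i => (hP.1.eigenvalues i : ℂ)) := by
    have h := hP.1.spectral_theorem
    rw [Unitary.conjStarAlgAut_apply] at h
    change P = U * Matrix.diagonal (fun i => (hP.1.eigenvalues i : ℂ)) * star U at h
    change star U * P = _ * star U
    nth_rewrite 1 [h]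
    rw [← mul_assoc, ← mul_assoc, hVU, one_mul]
  have hu : IsUnit (1 + P) := (Matrix.PosDef.one.add hP).isUnit
  have hp : ∀ i, 1 + (hP.1.eigenvalues i : ℂ) ≠ 0 := fun i => by
    have := hP.eigenvalues_pos i
    exact_mod_cast (by linarith : (0 : ℝ) < 1 + hP.1.eigenvalues i).ne'
  have hB : Tendsto (fun n => ∑ k ∈ Finset.range (n + 1), star U * A k) atTop
      (𝓝 (star U * S)) := by
    simpa only [Finset.mul_sum] using hA.const_mul (star U)
  have key : Tendsto (fun N => ∑ n ∈ Finset.range (N + 1), ∑ k ∈ Finset.range (n + 1),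
      (n.choose k : ℂ) • (star U * (((1 + P) ^ (n + 1))⁻¹ * P ^ (n - k) * A k)))
      atTop (𝓝 (star U * S)) := by
    refine tendsto_pi_nhds.2 fun i => tendsto_pi_nhds.2 fun j => ?_
    have hBij := tendsto_pi_nhds.1 (tendsto_pi_nhds.1 hB i) j
    simp only [Matrix.sum_apply] at hBij
    refine (tendsto_sum_euler_transform (hP.eigenvalues_pos i) hBij).congr fun N => ?_
    simp only [Matrix.sum_apply, Matrix.smul_apply, smul_eq_mul]
    refine Finset.sum_congr rfl fun n _ => Finset.sum_congr rfl fun k _ => ?_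
    rw [← mul_assoc (star U), (hV.euler_coeff hu hp (n + 1) (n - k)).eq,
      mul_assoc (Matrix.diagonal _), Matrix.diagonal_mul]
  have h := key.const_mul U
  rw [← mul_assoc, hUV, one_mul] at h
  refine h.congr fun N => ?_
  simp only [Finset.mul_sum, mul_smul_comm]
  refine Finset.sum_congr rfl fun n _ => Finset.sum_congr rfl fun k _ => ?_
  rw [← mul_assoc U, hUV, one_mul]
end

section
/- Let (A_k)_{k=0}^∞ be a sequence in ℂ^{d×d} and let P_1, P_2 ∈ ℂ^{d×d} be positive definite with P_2 − P_1 positive definite and P_1 P_2 = P_2 P_1. If Σ_{k=0}^∞ A_k is (E,P_1)-summable to S (i.e., Σ_{n=0}^∞ E_n^{P_1}(A) = S in the conventional sense), then Σ_{k=0}^∞ A_k is (E,P_2)-summable to S. -/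
open scoped ComplexOrder
open Filter Topology

/-- The Silverman–Toeplitz theorem for nonnegative lower triangular weights with unit row sums. -/
theorem tendsto_sum_smul_of_row_sum_eq_one {E : Type*} [NormedAddCommGroup E] [NormedSpace ℝ E]
    {a : ℕ → ℕ → ℝ} (ha : ∀ n k, 0 ≤ a n k) (hsum : ∀ n, ∑ k ∈ Finset.range (n + 1), a n k = 1)
    (hlim : ∀ k, Tendsto (fun n => a n k) atTop (𝓝 0)) {g : ℕ → E} {l : E}
    (hg : Tendsto g atTop (𝓝 l)) :
    Tendsto (fun n => ∑ k ∈ Finset.range (n + 1), a n k • g k) atTop (𝓝 l) := by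
  rw [Metric.tendsto_atTop] at hg
  rw [Metric.tendsto_nhds]
  intro ε hε
  obtain ⟨M, hM⟩ := hg (ε / 2) (by positivity)
  have hhead : Tendsto (fun n => ∑ k ∈ Finset.range M, a n k * ‖g k - l‖) atTop (𝓝 0) := by
    simpa using tendsto_finsetSum (Finset.range M) fun k _ => (hlim k).mul_const ‖g k - l‖
  filter_upwards [hhead.eventually_lt_const (show (0 : ℝ) < ε / 2 by positivity)] with n hn
  have hsub : ∑ k ∈ Finset.range (n + 1), a n k • g k - l =
      ∑ k ∈ Finset.range (n + 1), a n k • (g k - l) := by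
    simp only [smul_sub, Finset.sum_sub_distrib, ← Finset.sum_smul, hsum, one_smul]
  have hterm : ∀ k ∈ Finset.range (n + 1), ‖a n k • (g k - l)‖ ≤
      (if k < M then a n k * ‖g k - l‖ else 0) + a n k * (ε / 2) := by
    intro k _
    rw [norm_smul, Real.norm_of_nonneg (ha n k)]
    split_ifs with hk
    · have := mul_nonneg (ha n k) (half_pos hε).le
      linarith
    · have := (hM k (not_lt.1 hk)).le
      rw [dist_eq_norm] at this
      simpa using mul_le_mul_of_nonneg_left this (ha n k)
  have hfilter : ∑ k ∈ Finset.range (n + 1), (if k < M then a n k * ‖g k - l‖ else 0) ≤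
      ∑ k ∈ Finset.range M, a n k * ‖g k - l‖ := by
    rw [← Finset.sum_filter]
    refine Finset.sum_le_sum_of_subset_of_nonneg (fun k hk => ?_)
      fun k _ _ => mul_nonneg (ha n k) (norm_nonneg _)
    simp_all
  rw [dist_eq_norm, hsub]
  have hle := (norm_sum_le _ _).trans (Finset.sum_le_sum hterm)
  rw [Finset.sum_add_distrib, ← Finset.sum_mul, hsum] at hle
  linarith

/-- Scalar Euler means preserve limits. -/
theorem tendsto_sum_choose_mul_pow {w : ℝ} (hw₀ : 0 < w) (hw₁ : w < 1) {g : ℕ → ℂ} {l : ℂ}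
    (hg : Tendsto g atTop (𝓝 l)) :
    Tendsto (fun n => ∑ k ∈ Finset.range (n + 1),
      n.choose k • ((w : ℂ) ^ (n - k) * ((1 - (w : ℂ)) ^ k * g k))) atTop (𝓝 l) := by
  have h1w : 0 ≤ 1 - w := by linarith
  have key := tendsto_sum_smul_of_row_sum_eq_one
    (a := fun n k => (1 - w) ^ k * w ^ (n - k) * n.choose k)
    (fun n k => by positivity) (fun n => by rw [← add_pow]; simp) (fun k => ?_) hg
  · refine key.congr fun n => Finset.sum_congr rfl fun k _ => ?_
    simp only [Complex.real_smul, nsmul_eq_mul]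
    push_cast
    ring
  · rw [← tendsto_add_atTop_iff_nat k]
    have hs := (summable_choose_mul_geometric_of_norm_lt_one k
      (show ‖w‖ < 1 by rwa [Real.norm_of_nonneg hw₀.le])).tendsto_atTop_zero
    have := hs.const_mul ((1 - w) ^ k)
    rw [mul_zero] at this
    refine this.congr fun n => ?_
    rw [Nat.add_sub_cancel]
    ring

section BinomialTransform

variable {R : Type*} [Ring R]

/-- The binomial transform of a sequence, `∑ k ≤ n, (n choose k) X ^ (n - k) A k`. -/
def binomialTransform (X : R) (A : ℕ → R) (n : ℕ) : R :=
  ∑ k ∈ Finset.range (n + 1), n.choose k • (X ^ (n - k) * A k)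

theorem binomialTransform_zero (X : R) (A : ℕ → R) : binomialTransform X A 0 = A 0 := by
  simp [binomialTransform]

theorem binomialTransform_succ (X : R) (A : ℕ → R) (n : ℕ) :
    binomialTransform X A (n + 1) =
      X * binomialTransform X A n + binomialTransform X (fun k => A (k + 1)) n := by
  have := Finset.sum_choose_succ_nsmul (fun k j => X ^ j * A k) n
  simp only [binomialTransform, this, Finset.mul_sum, mul_smul_comm]
  congr 1
  refine Finset.sum_congr rfl fun k hk => ?_
  rw [Nat.succ_sub (Finset.mem_range_succ_iff.1 hk), pow_succ', mul_assoc]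

theorem binomialTransform_add (X : R) (A B : ℕ → R) (n : ℕ) :
    binomialTransform X (fun k => A k + B k) n =
      binomialTransform X A n + binomialTransform X B n := by
  simp [binomialTransform, mul_add, Finset.sum_add_distrib]

theorem binomialTransform_mul_left {X Y : R} (h : Commute X Y) (A : ℕ → R) (n : ℕ) :
    binomialTransform X (fun k => Y * A k) n = Y * binomialTransform X A n := by
  simp only [binomialTransform, Finset.mul_sum, mul_smul_comm]
  refine Finset.sum_congr rfl fun k _ => ?_
  rw [← mul_assoc, ← mul_assoc, (h.pow_left _).eq]

theorem binomialTransform_binomialTransform {X Y : R} (h : Commute X Y) (A : ℕ → R) (n : ℕ) :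
    binomialTransform X (binomialTransform Y A) n = binomialTransform (X + Y) A n := by
  induction n generalizing A with
  | zero => simp [binomialTransform_zero]
  | succ n ih =>
    rw [binomialTransform_succ, binomialTransform_succ (X + Y)]
    simp only [binomialTransform_succ Y A, binomialTransform_add,
      binomialTransform_mul_left h]
    rw [ih, ih, add_mul, add_assoc]

/-- Euler means of the partial sums of a series are partial sums of its Euler transform. -/
theorem sum_binomialTransform {W T : R} (hWT : W + T = 1) (e : ℕ → R) (N : ℕ) :
    ∑ n ∈ Finset.range N, binomialTransform W (fun k => T ^ (k + 1) * e k) n =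
      binomialTransform W (fun k => T ^ k * ∑ j ∈ Finset.range k, e j) N := by
  have hcomm : Commute W T := by
    rw [← eq_sub_iff_add_eq'] at hWT
    rw [hWT]
    exact (Commute.one_right W).sub_right (Commute.refl W)
  induction N with
  | zero => simp [binomialTransform_zero]
  | succ N ih =>
    rw [Finset.sum_range_succ, ih, binomialTransform_succ]
    simp only [Finset.sum_range_succ, mul_add, binomialTransform_add]
    simp only [pow_succ' T, mul_assoc, binomialTransform_mul_left hcomm]
    rw [← add_assoc, ← add_mul, hWT, one_mul]

end BinomialTransform

/-- The matrix Euler means attached to a Hermitian matrix with spectrum in `(0, 1)` preserve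
limits. -/
theorem tendsto_binomialTransform {d : Type*} [Fintype d] [DecidableEq d] {W : Matrix d d ℂ}
    (hW : W.IsHermitian) (hpos : ∀ i, 0 < hW.eigenvalues i) (hlt : ∀ i, hW.eigenvalues i < 1)
    {s : ℕ → Matrix d d ℂ} {S : Matrix d d ℂ} (hs : Tendsto s atTop (𝓝 S)) :
    Tendsto (binomialTransform W (fun k => (1 - W) ^ k * s k)) atTop (𝓝 S) := by
  set U : Matrix d d ℂ := (hW.eigenvectorUnitary : Matrix d d ℂ)
  set D : Matrix d d ℂ := Matrix.diagonal (fun i => (hW.eigenvalues i : ℂ)) with hD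
  have hUU : U * star U = 1 := Unitary.coe_mul_star_self _
  have hUU' : star U * U = 1 := Unitary.coe_star_mul_self _
  have hspec : W = U * D * star U := by
    conv_lhs => rw [hW.spectral_theorem]
    rfl
  have hconj : SemiconjBy (star U) W D := by
    rw [SemiconjBy, hspec, ← mul_assoc, ← mul_assoc, hUU', one_mul]
  have hconj' : SemiconjBy (star U) (1 - W) (1 - D) :=
    (SemiconjBy.one_right _).sub_right hconj
  have hone : 1 - D = Matrix.diagonal (fun i => 1 - (hW.eigenvalues i : ℂ)) := by
    rw [hD, ← Matrix.diagonal_one, Matrix.diagonal_sub]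
  have hdiag : Tendsto (fun n => star U * binomialTransform W (fun k => (1 - W) ^ k * s k) n)
      atTop (𝓝 (star U * S)) := by
    have hs' : Tendsto (fun k => star U * s k) atTop (𝓝 (star U * S)) := hs.const_mul _
    refine tendsto_pi_nhds.2 fun i => tendsto_pi_nhds.2 fun j => ?_
    have hij : Tendsto (fun k => (star U * s k) i j) atTop (𝓝 ((star U * S) i j)) :=
      tendsto_pi_nhds.1 (tendsto_pi_nhds.1 hs' i) j
    refine (tendsto_sum_choose_mul_pow (hpos i) (hlt i) hij).congr fun n => ?_
    have hrow : star U * binomialTransform W (fun k => (1 - W) ^ k * s k) n =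
        ∑ k ∈ Finset.range (n + 1),
          n.choose k • (D ^ (n - k) * ((1 - D) ^ k * (star U * s k))) := by
      simp only [binomialTransform, Finset.mul_sum, mul_smul_comm]
      refine Finset.sum_congr rfl fun k _ => ?_
      rw [← mul_assoc, (hconj.pow_right _).eq, mul_assoc, ← mul_assoc (star U),
        (hconj'.pow_right _).eq, mul_assoc]
    rw [hrow, Matrix.sum_apply]
    refine Finset.sum_congr rfl fun k _ => ?_
    rw [Matrix.smul_apply, hone, hD, Matrix.diagonal_pow, Matrix.diagonal_pow,
      Matrix.diagonal_mul, Matrix.diagonal_mul]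
    rfl
  have := hdiag.const_mul U
  simpa only [← mul_assoc, hUU, one_mul] using this

/-- If `X` and `Y` are positive definite and `X + Y` satisfies `(X + Y) W = X` with `W` Hermitian,
then the eigenvalues of `W` lie in `(0, 1)`. -/
theorem eigenvalues_mem_Ioo_of_add_mul_eq {d : Type*} [Fintype d] [DecidableEq d]
    {X Y W : Matrix d d ℂ} (hX : X.PosDef) (hY : Y.PosDef) (hW : W.IsHermitian)
    (h : (X + Y) * W = X) (i : d) : hW.eigenvalues i ∈ Set.Ioo 0 1 := by
  set v : d → ℂ := ⇑(hW.eigenvectorBasis i) with hv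
  have hv₀ : v ≠ 0 := fun hzero =>
    hW.eigenvectorBasis.orthonormal.ne_zero i (by ext j; exact congrFun hzero j)
  have hx := hX.re_dotProduct_pos hv₀
  have hy := hY.re_dotProduct_pos hv₀
  have heq : X.mulVec v = hW.eigenvalues i • (X + Y).mulVec v := by
    conv_lhs => rw [← h, ← Matrix.mulVec_mulVec, hv, hW.mulVec_eigenvectorBasis]
    rw [Matrix.mulVec_smul]
  have hre := congrArg (fun u => RCLike.re (dotProduct (star v) u)) heq
  simp only [dotProduct_smul, Matrix.add_mulVec, dotProduct_add] at hre
  simp only [RCLike.re_to_complex, Complex.smul_re, Complex.add_re, smul_eq_mul] at hre hx hy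
  constructor <;> by_contra! hc <;> nlinarith

/-- **Comparison of Euler summation methods in the Loewner order.**
Let `P₁, P₂` be commuting positive definite matrices with `P₂ - P₁` positive
definite (`P₁ ≺ P₂`). If the series `∑ₖ A k` is `(E, P₁)`-summable to `S`,
i.e. the partial sums of the `P₁`-Euler transforms converge to `S`, then it is
`(E, P₂)`-summable to `S`. -/
theorem euler_loewner_comparison (d : ℕ) (P₁ P₂ : Matrix (Fin d) (Fin d) ℂ)
    (hP₁ : P₁.PosDef) (hP₂ : P₂.PosDef) (hlt : (P₂ - P₁).PosDef)
    (hcomm : P₁ * P₂ = P₂ * P₁)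
    (A : ℕ → Matrix (Fin d) (Fin d) ℂ) (S : Matrix (Fin d) (Fin d) ℂ)
    (h : Tendsto (fun N => ∑ n ∈ Finset.range (N + 1),
        ∑ k ∈ Finset.range (n + 1),
          (n.choose k : ℂ) • (((1 + P₁) ^ (n + 1))⁻¹ * P₁ ^ (n - k) * A k))
      atTop (nhds S)) :
    Tendsto (fun N => ∑ n ∈ Finset.range (N + 1),
        ∑ k ∈ Finset.range (n + 1),
          (n.choose k : ℂ) • (((1 + P₂) ^ (n + 1))⁻¹ * P₂ ^ (n - k) * A k))
      atTop (nhds S) := by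
  set Q := P₂ - P₁ with hQ
  set R := 1 + P₁ with hR
  set V := 1 + P₂ with hV
  have hRpos : R.PosDef := Matrix.PosDef.one.add hP₁
  have hVpos : V.PosDef := Matrix.PosDef.one.add hP₂
  have hVR : V = Q + R := by rw [hV, hQ, hR]; abel
  have hRdet := (Matrix.isUnit_iff_isUnit_det _).1 hRpos.isUnit
  have hVdet := (Matrix.isUnit_iff_isUnit_det _).1 hVpos.isUnit
  have hVV : V * V⁻¹ = 1 := Matrix.mul_nonsing_inv _ hVdet
  have hVV' : V⁻¹ * V = 1 := Matrix.nonsing_inv_mul _ hVdet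
  have hc : Commute P₁ P₂ := hcomm
  have hQP : Commute Q P₁ := (hc.symm).sub_left (Commute.refl P₁)
  have hQR : Commute Q R := (Commute.one_right Q).add_right hQP
  have hVQ : Commute V Q := by
    rw [hVR]; exact (Commute.refl Q).add_left hQR.symm
  have hVRc : Commute V R := by
    rw [hVR]; exact hQR.add_left (Commute.refl R)
  have hinv : ∀ {Z}, Commute V Z → Commute V⁻¹ Z := fun {Z} hZ =>
    show V⁻¹ * Z = Z * V⁻¹ by
      calc V⁻¹ * Z = V⁻¹ * (Z * V) * V⁻¹ := by rw [mul_assoc, mul_assoc, hVV, mul_one]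
        _ = V⁻¹ * (V * Z) * V⁻¹ := by rw [hZ.eq]
        _ = Z * V⁻¹ := by rw [← mul_assoc V⁻¹, hVV', one_mul]
  have hiQ := hinv hVQ
  have hiR := hinv hVRc
  set W := V⁻¹ * Q with hWdef
  have hT : 1 - W = V⁻¹ * R := by
    rw [hWdef, sub_eq_iff_eq_add, ← mul_add, add_comm R, ← hVR, hVV']
  have hWherm : W.IsHermitian := by
    rw [Matrix.IsHermitian, hWdef, Matrix.conjTranspose_mul, hlt.isHermitian.eq,
      hVpos.isHermitian.inv.eq, hiQ.eq]
  have heig := eigenvalues_mem_Ioo_of_add_mul_eq hlt hRpos hWherm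
    (by rw [← hVR, hWdef, ← mul_assoc, hVV, one_mul])
  set e : ℕ → Matrix (Fin d) (Fin d) ℂ :=
    fun n => (R ^ (n + 1))⁻¹ * binomialTransform P₁ A n with he
  have heuler : ∀ P V : Matrix (Fin d) (Fin d) ℂ, ∀ n, ∑ k ∈ Finset.range (n + 1),
      (n.choose k : ℂ) • ((V ^ (n + 1))⁻¹ * P ^ (n - k) * A k) =
        (V ^ (n + 1))⁻¹ * binomialTransform P A n := fun P V n => by
    simp only [binomialTransform, Finset.mul_sum, Nat.cast_smul_eq_nsmul, mul_smul_comm, mul_assoc]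
  have hBe : binomialTransform P₁ A = fun n => R ^ (n + 1) * e n := by
    funext n
    rw [he, ← mul_assoc, Matrix.mul_nonsing_inv _ (by rw [Matrix.det_pow]; exact hRdet.pow _),
      one_mul]
  have htransform : ∀ n, (V ^ (n + 1))⁻¹ * binomialTransform P₂ A n =
      binomialTransform W (fun k => (1 - W) ^ (k + 1) * e k) n := fun n => by
    rw [show P₂ = Q + P₁ by rw [hQ]; abel, ← binomialTransform_binomialTransform hQP, hBe,
      ← Matrix.inv_pow', hT]
    simp only [binomialTransform, Finset.mul_sum, mul_smul_comm]
    refine Finset.sum_congr rfl fun k hk => ?_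
    congr 1
    have hn : n + 1 = (n - k) + (k + 1) := by
      have := Finset.mem_range_succ_iff.1 hk
      omega
    rw [hWdef, hiQ.mul_pow, hiR.mul_pow]
    conv_lhs => rw [hn, pow_add]
    simp only [← mul_assoc]
    congr 2
    rw [mul_assoc, mul_assoc, (hiQ.pow_pow _ _).eq]
  simp only [heuler] at h ⊢
  simp only [htransform, sum_binomialTransform (add_sub_cancel W 1)]
  rw [tendsto_add_atTop_iff_nat (f := fun N => ∑ n ∈ Finset.range N, e n) 1] at h
  exact (tendsto_binomialTransform hWherm (fun i => (heig i).1) (fun i => (heig i).2) h).comp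
    (tendsto_add_atTop_nat 1)
end

section
/- Let (A_k)_{k=1}^∞ be a sequence in ℂ^{d×d} and S ∈ ℂ^{d×d}. If Σ_{k=1}^∞ A_k converges in the conventional sense to S, then Σ_{k=1}^∞ A_k is Lambert summable to S: for every x ∈ (0,1) the series Σ_{k=1}^∞ (k x^k / (1 − x^k)) A_k converges in the conventional sense, and lim_{x→1⁻} (1−x) Σ_{k=1}^∞ (k x^k / (1 − x^k)) A_k = S (regularity of Lambert summation). -/
open Filter Topology

/-- Abel's inequality for nonnegative antitone weights. -/
theorem norm_sum_antitone_smul_le {E : Type*} [NormedAddCommGroup E] [NormedSpace ℝ E]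
    {f : ℕ → ℝ} {z : ℕ → E} {b : ℝ} (hf : Antitone f) (hf0 : ∀ n, 0 ≤ f n)
    (hb : ∀ n, ‖∑ i ∈ Finset.range n, z i‖ ≤ b) (n : ℕ) :
    ‖∑ i ∈ Finset.range n, f i • z i‖ ≤ f 0 * b := by
  have abel : ∀ n, ∑ i ∈ Finset.range n, f i • z i =
      f n • ∑ i ∈ Finset.range n, z i +
        ∑ k ∈ Finset.range n, (f k - f (k + 1)) • ∑ i ∈ Finset.range (k + 1), z i := by
    intro n
    induction n with
    | zero => simp
    | succ n ih =>
      rw [Finset.sum_range_succ, ih, Finset.sum_range_succ (fun k => (f k - f (k + 1)) • _) n,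
        Finset.sum_range_succ z n]
      module
  rw [abel n]
  calc _ ≤ f n * b + ∑ k ∈ Finset.range n, (f k - f (k + 1)) * b := by
        refine (norm_add_le _ _).trans (add_le_add ?_ ((norm_sum_le _ _).trans
          (Finset.sum_le_sum fun k _ => ?_)))
        · rw [norm_smul, Real.norm_of_nonneg (hf0 n)]
          exact mul_le_mul_of_nonneg_left (hb n) (hf0 n)
        · have h : 0 ≤ f k - f (k + 1) := sub_nonneg.2 (hf k.le_succ)
          rw [norm_smul, Real.norm_of_nonneg h]
          exact mul_le_mul_of_nonneg_left (hb _) h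
    _ = f 0 * b := by
        rw [← Finset.sum_mul, Finset.sum_range_sub']
        ring

/-- Summation by antitone null weights `w x`, bounded by `1` and tending pointwise to `1` along
`l`, is regular. -/
theorem tendsto_of_antitone_weights {E X : Type*} [NormedAddCommGroup E] [NormedSpace ℝ E]
    {l : Filter X} {w : X → ℕ → ℝ} {a : ℕ → E} {S : E} {G : X → E}
    (ha : Tendsto (fun n => ∑ k ∈ Finset.range n, a k) atTop (𝓝 S))
    (hw : ∀ᶠ x in l, Antitone (w x)) (hw0 : ∀ᶠ x in l, ∀ k, 0 ≤ w x k)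
    (hw1 : ∀ᶠ x in l, w x 0 ≤ 1) (hlim : ∀ k, Tendsto (fun x => w x k) l (𝓝 1))
    (hG : ∀ᶠ x in l, Tendsto (fun n => ∑ k ∈ Finset.range n, w x k • a k) atTop (𝓝 (G x))) :
    Tendsto G l (𝓝 S) := by
  have hunif : TendstoUniformlyOnFilter
      (fun n x => ∑ k ∈ Finset.range n, w x k • a k) G atTop l := by
    rw [Metric.tendstoUniformlyOnFilter_iff]
    intro ε hε
    obtain ⟨N, hN⟩ := Metric.cauchySeq_iff.1 ha.cauchySeq (ε / 2) (half_pos hε)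
    refine ((eventually_ge_atTop N).prod_mk (hw.and (hw0.and (hw1.and hG)))).mono ?_
    rintro ⟨m, x⟩ ⟨hm, hanti, hnn, hone, hGx⟩
    have htail : ∀ n, ‖∑ k ∈ Finset.range n, w x (m + k) • a (m + k)‖ ≤ ε / 2 := by
      intro n
      have hb : ∀ n, ‖∑ k ∈ Finset.range n, a (m + k)‖ ≤ ε / 2 := by
        intro n
        have h := (hN (m + n) (hm.trans (Nat.le_add_right m n)) m hm).le
        rwa [dist_eq_norm, Finset.sum_range_add, add_sub_cancel_left] at h
      refine (norm_sum_antitone_smul_le (f := fun k => w x (m + k))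
        (fun i j hij => hanti (Nat.add_le_add_left hij m)) (fun k => hnn _) hb n).trans ?_
      exact mul_le_of_le_one_left (half_pos hε).le ((hanti (Nat.zero_le _)).trans hone)
    have hdist : dist (G x) (∑ k ∈ Finset.range m, w x k • a k) ≤ ε / 2 := by
      refine le_of_tendsto (hGx.dist tendsto_const_nhds) ?_
      filter_upwards [eventually_ge_atTop m] with n hn
      obtain ⟨r, rfl⟩ := Nat.exists_eq_add_of_le hn
      rw [dist_eq_norm, Finset.sum_range_add, add_sub_cancel_left]
      exact htail r
    exact hdist.trans_lt (half_lt_self hε)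
  refine hunif.tendsto_of_eventually_tendsto (Eventually.of_forall fun n => ?_) ha
  refine tendsto_finsetSum _ fun k _ => ?_
  simpa using (hlim k).smul_const (a k)

/-- The coefficient of the term of index `k + 1` in Lambert summation. -/
noncomputable def lambertWeight (x : ℝ) (k : ℕ) : ℝ :=
  ((k + 1 : ℕ) : ℝ) * x ^ (k + 1) / (1 - x ^ (k + 1))

theorem lambertWeight_nonneg {x : ℝ} (hx : x ∈ Set.Ioo (0 : ℝ) 1) (k : ℕ) :
    0 ≤ lambertWeight x k :=
  div_nonneg (mul_nonneg (Nat.cast_nonneg _) (pow_nonneg hx.1.le _))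
    (sub_nonneg.2 (pow_le_one₀ hx.1.le hx.2.le))

theorem lambertWeight_antitone {x : ℝ} (hx : x ∈ Set.Ioo (0 : ℝ) 1) :
    Antitone (lambertWeight x) := by
  refine antitone_nat_of_succ_le fun k => ?_
  have hpos (m : ℕ) : 0 < 1 - x ^ (m + 1) :=
    sub_pos.2 (pow_lt_one₀ hx.1.le hx.2 m.succ_ne_zero)
  have bernoulli := one_add_mul_le_pow (a := x - 1) (by linarith [hx.1]) (k + 2)
  rw [add_sub_cancel] at bernoulli
  push_cast at bernoulli
  unfold lambertWeight
  rw [div_le_div_iff₀ (hpos (k + 1)) (hpos k)]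
  push_cast
  have h := mul_le_mul_of_nonneg_left bernoulli (pow_nonneg hx.1.le (k + 1))
  rw [show k + 1 + 1 = k + 2 from rfl]
  have e : x ^ (k + 2) = x ^ (k + 1) * x := pow_succ x (k + 1)
  rw [e] at h ⊢
  linarith

theorem tendsto_lambertWeight_atTop {x : ℝ} (hx : x ∈ Set.Ioo (0 : ℝ) 1) :
    Tendsto (lambertWeight x) atTop (𝓝 0) := by
  have hnum := tendsto_self_mul_const_pow_of_lt_one hx.1.le hx.2
  have hden := (tendsto_pow_atTop_nhds_zero_of_lt_one hx.1.le hx.2).const_sub 1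
  have h := hnum.div hden (by norm_num)
  rw [zero_div] at h
  exact h.comp (tendsto_add_atTop_nat 1)

theorem one_sub_mul_lambertWeight {x : ℝ} (hx : x ∈ Set.Ioo (0 : ℝ) 1) (k : ℕ) :
    (1 - x) * lambertWeight x k =
      ((k + 1 : ℕ) : ℝ) * x ^ (k + 1) / ∑ i ∈ Finset.range (k + 1), x ^ i := by
  have h1 : 1 - x ≠ 0 := (sub_pos.2 hx.2).ne'
  rw [lambertWeight, ← mul_neg_geom_sum x (k + 1), mul_div_assoc', mul_div_mul_left _ _ h1]

theorem tendsto_one_sub_mul_lambertWeight (k : ℕ) :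
    Tendsto (fun x : ℝ => (1 - x) * lambertWeight x k) (𝓝[Set.Ioo 0 1] 1) (𝓝 1) := by
  have hk : ((k + 1 : ℕ) : ℝ) ≠ 0 := Nat.cast_ne_zero.2 k.succ_ne_zero
  have h : ContinuousAt (fun x : ℝ => ((k + 1 : ℕ) : ℝ) * x ^ (k + 1) /
      ∑ i ∈ Finset.range (k + 1), x ^ i) 1 := by
    refine ContinuousAt.div (by fun_prop) (by fun_prop) ?_
    simpa using hk
  have h' := h.tendsto.mono_left (nhdsWithin_le_nhds (s := Set.Ioo 0 1))
  simp only [one_pow, mul_one, Finset.sum_const, Finset.card_range, nsmul_eq_mul,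
    div_self hk] at h'
  refine h'.congr' ?_
  filter_upwards [self_mem_nhdsWithin] with x hx
  exact (one_sub_mul_lambertWeight hx k).symm

/-- Regularity of Lambert summation in a Banach space. -/
theorem exists_tendsto_lambertWeight {E : Type*} [NormedAddCommGroup E] [NormedSpace ℝ E]
    [CompleteSpace E] {a : ℕ → E} {S : E}
    (ha : Tendsto (fun n => ∑ k ∈ Finset.range n, a k) atTop (𝓝 S)) :
    ∃ g : ℝ → E,
      (∀ x ∈ Set.Ioo (0 : ℝ) 1,
        Tendsto (fun n => ∑ k ∈ Finset.range n, lambertWeight x k • a k) atTop (𝓝 (g x))) ∧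
      Tendsto (fun x => (1 - x) • g x) (𝓝[Set.Ioo 0 1] 1) (𝓝 S) := by
  obtain ⟨b, hb⟩ := ha.norm.bddAbove_range
  have hconv : ∀ x : ℝ, ∃ y : E, x ∈ Set.Ioo (0 : ℝ) 1 →
      Tendsto (fun n => ∑ k ∈ Finset.range n, lambertWeight x k • a k) atTop (𝓝 y) := by
    intro x
    by_cases hx : x ∈ Set.Ioo (0 : ℝ) 1
    · obtain ⟨y, hy⟩ := cauchySeq_tendsto_of_complete
        ((lambertWeight_antitone hx).cauchySeq_series_mul_of_tendsto_zero_of_bounded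
          (tendsto_lambertWeight_atTop hx) fun n => hb ⟨n, rfl⟩)
      exact ⟨y, fun _ => hy⟩
    · exact ⟨0, fun h => absurd h hx⟩
  choose g hg using hconv
  refine ⟨g, hg, ?_⟩
  have hmem : ∀ᶠ x in 𝓝[Set.Ioo (0 : ℝ) 1] 1, x ∈ Set.Ioo (0 : ℝ) 1 := self_mem_nhdsWithin
  refine tendsto_of_antitone_weights (w := fun x k => (1 - x) * lambertWeight x k) ha
    ?_ ?_ ?_ tendsto_one_sub_mul_lambertWeight ?_ <;> filter_upwards [hmem] with x hx
  · exact (lambertWeight_antitone hx).const_mul (sub_pos.2 hx.2).le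
  · exact fun k => mul_nonneg (sub_pos.2 hx.2).le (lambertWeight_nonneg hx k)
  · rw [one_sub_mul_lambertWeight hx]
    simpa using hx.2.le
  · simpa only [Finset.smul_sum, smul_smul] using (hg x hx).const_smul (1 - x)

theorem sum_Icc_one_eq_sum_range {M : Type*} [AddCommMonoid M] (f : ℕ → M) (n : ℕ) :
    ∑ k ∈ Finset.Icc 1 n, f k = ∑ k ∈ Finset.range n, f (k + 1) := by
  rw [Finset.range_eq_Ico, Finset.sum_Ico_add' f 0 n 1]
  rfl

/-- **Regularity of Lambert summation for matrix series.**
If the matrix series `∑_{k≥1} A k` converges in the conventional sense to `S`,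
then it is Lambert summable to `S`: for every `x ∈ (0,1)` the series
`∑_{k≥1} (k x^k / (1 - x^k)) • A k` converges in the conventional sense, and
`(1-x)` times its value tends to `S` as `x → 1⁻`. -/
theorem lambert_regularity (d : ℕ)
    (A : ℕ → Matrix (Fin d) (Fin d) ℂ) (S : Matrix (Fin d) (Fin d) ℂ)
    (hA : Tendsto (fun n => ∑ k ∈ Finset.Icc 1 n, A k) atTop (nhds S)) :
    ∃ g : ℝ → Matrix (Fin d) (Fin d) ℂ,
      (∀ x ∈ Set.Ioo (0 : ℝ) 1,
        Tendsto (fun n : ℕ => ∑ k ∈ Finset.Icc 1 n,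
            ((k : ℂ) * (x : ℂ) ^ k / (1 - (x : ℂ) ^ k)) • A k)
          atTop (nhds (g x))) ∧
      Tendsto (fun x : ℝ => (1 - (x : ℂ)) • g x)
        (nhdsWithin 1 (Set.Ioo 0 1)) (nhds S) := by
  let _ : NormedAddCommGroup (Matrix (Fin d) (Fin d) ℂ) := Matrix.normedAddCommGroup
  let _ : NormedSpace ℝ (Matrix (Fin d) (Fin d) ℂ) := Matrix.normedSpace
  have : CompleteSpace (Matrix (Fin d) (Fin d) ℂ) := FiniteDimensional.complete ℝ _
  simp only [sum_Icc_one_eq_sum_range] at hA ⊢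
  have hsmul (r : ℝ) (M : Matrix (Fin d) (Fin d) ℂ) : r • M = (r : ℂ) • M := by
    ext i j
    simp
  obtain ⟨g, hg, hlim⟩ := exists_tendsto_lambertWeight hA
  refine ⟨g, fun x hx => ?_, ?_⟩
  · refine (hg x hx).congr fun n => Finset.sum_congr rfl fun k _ => ?_
    rw [hsmul, lambertWeight]
    push_cast
    rfl
  · refine hlim.congr fun x => ?_
    rw [hsmul]
    push_cast
    rfl
end
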